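/- Let B be an instance of (2,2)-E3-SAT and let J be the TAP-SS instance constructed from B as described. If J admits an applicant-complete stable matching M, then B admits a satisfying truth assignment (namely, setting v_i true if T_i ⊆ M and false if F_i ⊆ M satisfies B). -/

import Mathlib

/-- The three subjects. -/
inductive Subj : Type where
  | F | I | M
deriving DecidableEq

/-- An instance of (2,2)-E3-SAT with variables `Fin n` and clauses `Fin m`:
`clause j t` is the literal (variable, polarity) in position `t` of clause `j`;
`occurs v b o` is the (clause, position) of the `o`-th occurrence of the literal
`(v, b)`, and `occInv` is its two-sided inverse, so that each clause has exactly
3 literals and each literal occurs exactly twice. -/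
structure E3SAT (n m : ℕ) where
  clause : Fin m → Fin 3 → Fin n × Bool
  occurs : Fin n → Bool → Fin 2 → Fin m × Fin 3
  occInv : Fin m → Fin 3 → Fin n × Bool × Fin 2
  clause_occurs : ∀ v b o, clause (occurs v b o).1 (occurs v b o).2 = (v, b)
  occurs_occInv : ∀ j t, occurs (occInv j t).1 (occInv j t).2.1 (occInv j t).2.2 = (j, t)
  occInv_occurs : ∀ v b o, occInv (occurs v b o).1 (occurs v b o).2 = (v, b, o)

/-- `f` is a satisfying truth assignment of `B`. -/
def E3SAT.Satisfies {n m : ℕ} (B : E3SAT n m) (f : Fin n → Bool) : Prop :=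
  ∀ j : Fin m, ∃ t : Fin 3, f (B.clause j t).1 = (B.clause j t).2
/-- An instance of TAP-SS: like TAP but each school has a separate preference
list of applicants for each subject. -/
structure TAPSS (A : Type*) (S : Type*) (P : Type*) where
  ptype : A → Finset P
  prefA : A → List S
  cap : S → P → ℕ
  prefSp : S → P → List A

namespace TAPSS

variable {A S P : Type*} [DecidableEq A] [DecidableEq S] [DecidableEq P] (J : TAPSS A S P)

def IsAssignment (M : Finset (A × S)) : Prop :=
  (∀ x ∈ M, x.2 ∈ J.prefA x.1) ∧
  ∀ a s s', (a, s) ∈ M → (a, s') ∈ M → s = s'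

def Mp (M : Finset (A × S)) (s : S) (p : P) : Finset A :=
  (M.filter (fun x => x.2 = s ∧ p ∈ J.ptype x.1)).image Prod.fst

def Mpr (M : Finset (A × S)) (s : S) (p r : P) : Finset A :=
  (M.filter (fun x => x.2 = s ∧ J.ptype x.1 = {p, r})).image Prod.fst

def IsMatching (M : Finset (A × S)) : Prop :=
  J.IsAssignment M ∧ ∀ s p, (J.Mp M s p).card ≤ J.cap s p

def Undersub (M : Finset (A × S)) (s : S) (p : P) : Prop :=
  (J.Mp M s p).card < J.cap s p

def PrefersA (a : A) (s s' : S) : Prop :=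
  s ∈ J.prefA a ∧ s' ∈ J.prefA a ∧ (J.prefA a).idxOf s < (J.prefA a).idxOf s'

/-- School `s` prefers `a` to `a'` in subject `p`. -/
def PrefersS (s : S) (p : P) (a a' : A) : Prop :=
  a ∈ J.prefSp s p ∧ a' ∈ J.prefSp s p ∧
    (J.prefSp s p).idxOf a < (J.prefSp s p).idxOf a'

def Unassigned (M : Finset (A × S)) (a : A) : Prop := ∀ s, (a, s) ∉ M

def Blocks (M : Finset (A × S)) (a : A) (s : S) : Prop :=
  s ∈ J.prefA a ∧
  (Unassigned M a ∨ ∃ s', (a, s') ∈ M ∧ J.PrefersA a s s') ∧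
  ∃ p₁ p₂, p₁ ≠ p₂ ∧ J.ptype a = {p₁, p₂} ∧
    ((J.Undersub M s p₁ ∧ J.Undersub M s p₂) ∨
     (J.Undersub M s p₁ ∧ ∃ b ∈ J.Mp M s p₂, J.PrefersS s p₂ a b) ∨
     (J.Undersub M s p₂ ∧ ∃ b ∈ J.Mp M s p₁, J.PrefersS s p₁ a b) ∨
     (∃ b ∈ J.Mpr M s p₁ p₂, J.PrefersS s p₁ a b ∧ J.PrefersS s p₂ a b) ∨
     (∃ b₁ ∈ J.Mp M s p₁, ∃ b₂ ∈ J.Mp M s p₂,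
        b₁ ≠ b₂ ∧ J.PrefersS s p₁ a b₁ ∧ J.PrefersS s p₂ a b₂))

def Stable (M : Finset (A × S)) : Prop :=
  J.IsMatching M ∧ ∀ a s, ¬ J.Blocks M a s

/-- Every applicant is assigned. -/
def ApplicantComplete (_J : TAPSS A S P) (M : Finset (A × S)) : Prop :=
  ∀ a : A, ∃ s, (a, s) ∈ M

end TAPSS
/-- The applicants of the TAP-SS instance constructed from a (2,2)-E3-SAT instance:
`x i r` is the applicant `x_{4i+r}` of the paper, `q j` is `q_{j+1}` and
`w j t` is `w_{j+1}^{t+1}`. -/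
inductive SApp (n m : ℕ) : Type where
  | x (i : Fin n) (r : Fin 4)
  | q (j : Fin m)
  | w (j : Fin m) (t : Fin 3)
deriving DecidableEq

/-- The schools of the TAP-SS instance constructed from a (2,2)-E3-SAT instance:
`y i r` is the school `y_{4i+r}` of the paper, `s j t` is `s_{j+1}^{t+1}` and
`s4 j` is `s_{j+1}^4`. -/
inductive SSch (n m : ℕ) : Type where
  | y (i : Fin n) (r : Fin 4)
  | s (j : Fin m) (t : Fin 3)
  | s4 (j : Fin m)
deriving DecidableEq

variable {n m : ℕ}

/-- The school `s(x_{4i+r})` housing the literal occurrence that applicant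
`x_{4i+r}` corresponds to. -/
def sx (B : E3SAT n m) (i : Fin n) (r : Fin 4) : SSch n m :=
  if h : r.1 < 2 then
    SSch.s (B.occurs i true ⟨r.1, h⟩).1 (B.occurs i true ⟨r.1, h⟩).2
  else
    SSch.s (B.occurs i false ⟨r.1 - 2, by have := r.2; omega⟩).1
      (B.occurs i false ⟨r.1 - 2, by have := r.2; omega⟩).2

open Subj in
/-- Types of the applicants: all x-applicants are FI, all q- and w-applicants are FM. -/
def ssPtype : SApp n m → Finset Subj
  | .x _ _ => {F, I}
  | .q _ => {F, M}
  | .w _ _ => {F, M}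

/-- Preference lists of the applicants. -/
def ssPrefA (B : E3SAT n m) : SApp n m → List (SSch n m)
  | .x i r =>
      if r = 0 then [.y i 0, sx B i r, .y i 1]
      else if r = 1 then [.y i 1, sx B i r, .y i 2]
      else if r = 2 then [.y i 3, sx B i r, .y i 2]
      else [.y i 0, sx B i r, .y i 3]
  | .q j => [.s j 0, .s j 1, .s j 2]
  | .w j t => [.s j t, .s4 j]

open Subj in
/-- Capacities of the schools. -/
def ssCap : SSch n m → Subj → ℕ
  | .y _ _, p => if p = M then 0 else 1
  | .s _ _, _ => 1
  | .s4 _, p => if p = I then 0 else 1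

/-- `⟨X⟩`: the x-applicants in increasing subscript order. -/
def Xlist (n m : ℕ) : List (SApp n m) :=
  (List.finRange n).flatMap fun i => (List.finRange 4).map fun r => SApp.x i r

/-- `⟨Q⟩`: the q-applicants in increasing subscript order. -/
def Qlist (n m : ℕ) : List (SApp n m) := (List.finRange m).map SApp.q

/-- `⟨W⟩`: the w-applicants ordered by increasing subscript and, within equal
subscript, increasing superscript. -/
def Wlist (n m : ℕ) : List (SApp n m) :=
  (List.finRange m).flatMap fun j => (List.finRange 3).map fun t => SApp.w j t

open Subj in
/-- The subject-specific master lists of applicants: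
F: ⟨W⟩ ⟨X⟩ ⟨Q⟩; I: ⟨X̄⟩; M: ⟨Q⟩ ⟨W̄⟩. -/
def ssMaster (n m : ℕ) : Subj → List (SApp n m)
  | F => Wlist n m ++ Xlist n m ++ Qlist n m
  | I => (Xlist n m).reverse
  | M => Qlist n m ++ (Wlist n m).reverse

/-- The TAP-SS instance `J` constructed from the (2,2)-E3-SAT instance `B`;
each school's preference list for subject `p` is the restriction of the master
list for `p` to the applicants whose type includes `p` and who find the school
acceptable. -/
def ssOf (B : E3SAT n m) : TAPSS (SApp n m) (SSch n m) Subj where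
  ptype := ssPtype
  prefA := ssPrefA B
  cap s p := ssCap s p
  prefSp s p := (ssMaster n m p).filter
    (fun a => decide (s ∈ ssPrefA B a) && decide (p ∈ ssPtype a))

/-- The set of pairs `T_i = {(x_{4i+r}, y_{4i+r}) : 0 ≤ r ≤ 3}`. -/
def ssT (i : Fin n) : Finset (SApp n m × SSch n m) :=
  {(.x i 0, .y i 0), (.x i 1, .y i 1), (.x i 2, .y i 2), (.x i 3, .y i 3)}

/-- The set of pairs `F_i = {(x_{4i+r}, y_{4i+r+1}) : 0 ≤ r ≤ 2} ∪ {(x_{4i+3}, y_{4i})}`. -/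
def ssF (i : Fin n) : Finset (SApp n m × SSch n m) :=
  {(.x i 0, .y i 1), (.x i 1, .y i 2), (.x i 2, .y i 3), (.x i 3, .y i 0)}

theorem prefersS_x_q (B : E3SAT n m) {s : SSch n m} {i : Fin n} {r : Fin 4} {j : Fin m}
    (hx : s ∈ ssPrefA B (.x i r)) (hq : s ∈ ssPrefA B (.q j)) :
    (ssOf B).PrefersS s .F (.x i r) (.q j) := by
  have hX : (SApp.x i r : SApp n m) ∈ (Wlist n m ++ Xlist n m).filter
      (fun a => decide (s ∈ ssPrefA B a) && decide (Subj.F ∈ ssPtype a)) := by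
    simp [Wlist, Xlist, hx, ssPtype]
  have hQ : (SApp.q j : SApp n m) ∉ (Wlist n m ++ Xlist n m).filter
      (fun a => decide (s ∈ ssPrefA B a) && decide (Subj.F ∈ ssPtype a)) := by
    simp [Wlist, Xlist]
  have hQ' : (SApp.q j : SApp n m) ∈ (Qlist n m).filter
      (fun a => decide (s ∈ ssPrefA B a) && decide (Subj.F ∈ ssPtype a)) := by
    simp [Qlist, hq, ssPtype]
  simp only [TAPSS.PrefersS, ssOf, ssMaster]
  rw [List.filter_append (Wlist n m ++ Xlist n m)]
  refine ⟨List.mem_append_left _ hX, List.mem_append_right _ hQ', ?_⟩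
  rw [List.idxOf_append_of_mem hX, List.idxOf_append_of_notMem hQ]
  have := List.idxOf_lt_length_of_mem hX
  omega

theorem mem_Mp_F (B : E3SAT n m) {M : Finset (SApp n m × SSch n m)} {a : SApp n m}
    {s : SSch n m} : a ∈ (ssOf B).Mp M s .F ↔ (a, s) ∈ M := by
  have hF : ∀ b : SApp n m, Subj.F ∈ (ssOf B).ptype b := fun b => by
    cases b <;> simp [ssOf, ssPtype]
  simp [TAPSS.Mp, hF]

/-- Every school admits at most one applicant. -/
theorem eq_of_mem_of_mem {B : E3SAT n m} {M : Finset (SApp n m × SSch n m)}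
    (hM : (ssOf B).IsMatching M) {a b : SApp n m} {s : SSch n m}
    (ha : (a, s) ∈ M) (hb : (b, s) ∈ M) : a = b := by
  have hcap : (ssOf B).cap s .F ≤ 1 := by cases s <;> simp [ssOf, ssCap]
  exact Finset.card_le_one.1 ((hM.2 s .F).trans hcap) a ((mem_Mp_F B).2 ha) b ((mem_Mp_F B).2 hb)

theorem exists_mem_q {B : E3SAT n m} {M : Finset (SApp n m × SSch n m)}
    (hM : (ssOf B).IsMatching M) (hac : (ssOf B).ApplicantComplete M) (j : Fin m) :
    ∃ t, (SApp.q j, SSch.s j t) ∈ M := by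
  obtain ⟨s, hs⟩ := hac (.q j)
  have h := hM.1.1 _ hs
  simp only [ssOf, ssPrefA, List.mem_cons, List.not_mem_nil, or_false] at h
  rcases h with rfl | rfl | rfl <;> exact ⟨_, hs⟩

theorem w_mem {B : E3SAT n m} {M : Finset (SApp n m × SSch n m)}
    (hM : (ssOf B).IsMatching M) (hac : (ssOf B).ApplicantComplete M) (j : Fin m) (t : Fin 3) :
    (SApp.w j t, SSch.s j t) ∈ M ∨ (SApp.w j t, SSch.s4 j) ∈ M := by
  obtain ⟨s, hs⟩ := hac (.w j t)
  have h := hM.1.1 _ hs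
  simp only [ssOf, ssPrefA, List.mem_cons, List.not_mem_nil, or_false] at h
  rcases h with rfl | rfl
  · exact .inl hs
  · exact .inr hs

/-- The q- and w-applicants of a clause occupy all of its schools. -/
theorem x_notMem_s {B : E3SAT n m} {M : Finset (SApp n m × SSch n m)}
    (hM : (ssOf B).IsMatching M) (hac : (ssOf B).ApplicantComplete M)
    (i : Fin n) (r : Fin 4) (j : Fin m) (t : Fin 3) : (SApp.x i r, SSch.s j t) ∉ M := by
  intro hx
  obtain ⟨t', hq⟩ := exists_mem_q hM hac j
  have hwt : (SApp.w j t, SSch.s4 j) ∈ M :=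
    (w_mem hM hac j t).resolve_left fun h => by cases eq_of_mem_of_mem hM h hx
  have hwt' : (SApp.w j t', SSch.s4 j) ∈ M :=
    (w_mem hM hac j t').resolve_left fun h => by cases eq_of_mem_of_mem hM h hq
  cases eq_of_mem_of_mem hM hwt hwt'
  cases eq_of_mem_of_mem hM hx hq

theorem exists_sx_eq (B : E3SAT n m) (i : Fin n) (r : Fin 4) : ∃ j t, sx B i r = .s j t := by
  unfold sx
  split <;> exact ⟨_, _, rfl⟩

theorem x_notMem_sx {B : E3SAT n m} {M : Finset (SApp n m × SSch n m)}
    (hM : (ssOf B).IsMatching M) (hac : (ssOf B).ApplicantComplete M)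
    (i : Fin n) (r : Fin 4) : (SApp.x i r, sx B i r) ∉ M := by
  obtain ⟨j, t, h⟩ := exists_sx_eq B i r
  rw [h]
  exact x_notMem_s hM hac i r j t

/-- The x-applicant of a literal occurrence whose school hosts `q j` gets a school it prefers. -/
theorem not_prefersA_sx {B : E3SAT n m} {M : Finset (SApp n m × SSch n m)}
    (hst : (ssOf B).Stable M) {i : Fin n} {r : Fin 4} {j : Fin m} {z : SSch n m}
    (hq : (SApp.q j, sx B i r) ∈ M) (hz : (SApp.x i r, z) ∈ M) :
    ¬ (ssOf B).PrefersA (.x i r) (sx B i r) z := by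
  intro hp
  refine hst.2 (.x i r) (sx B i r) ⟨hp.1, .inr ⟨z, hz, hp⟩, .F, .I, by decide, rfl,
    .inr (.inr (.inl ⟨?_, .q j, (mem_Mp_F B).2 hq, prefersS_x_q B hp.1 (hst.1.1.1 _ hq)⟩))⟩
  have hcap : (ssOf B).cap (sx B i r) .I = 1 := by
    obtain ⟨j, t, h⟩ := exists_sx_eq B i r
    simp [h, ssOf, ssCap]
  have hempty : (ssOf B).Mp M (sx B i r) .I = ∅ := by
    refine Finset.eq_empty_of_forall_notMem fun a ha => ?_
    simp only [TAPSS.Mp, Finset.mem_image, Finset.mem_filter] at ha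
    obtain ⟨⟨a, s⟩, ⟨hmem, rfl, hI⟩, rfl⟩ := ha
    cases eq_of_mem_of_mem hst.1 hmem hq
    simp [ssOf, ssPtype] at hI
  simp [TAPSS.Undersub, hcap, hempty]

/-- The first and last choices of `x_{4i+r}` are `y_{4i+r.1}` and `y_{4i+r.2}`. -/
def xEnds (r : Fin 4) : Fin 4 × Fin 4 :=
  if r = 0 then (0, 1) else if r = 1 then (1, 2) else if r = 2 then (3, 2) else (0, 3)

theorem ssPrefA_x (B : E3SAT n m) (i : Fin n) (r : Fin 4) :
    ssPrefA B (.x i r) = [.y i (xEnds r).1, sx B i r, .y i (xEnds r).2] := by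
  fin_cases r <;> rfl

theorem xEnds_fst_ne (r : Fin 4) : (xEnds r).1 ≠ (xEnds r).2 := by
  revert r
  decide

theorem x_mem_y {B : E3SAT n m} {M : Finset (SApp n m × SSch n m)}
    (hM : (ssOf B).IsMatching M) (hac : (ssOf B).ApplicantComplete M) (i : Fin n) (r : Fin 4) :
    (SApp.x i r, SSch.y i (xEnds r).1) ∈ M ∨ (SApp.x i r, SSch.y i (xEnds r).2) ∈ M := by
  obtain ⟨s, hs⟩ := hac (.x i r)
  have h : s ∈ ssPrefA B (.x i r) := hM.1.1 _ hs
  simp only [ssPrefA_x, List.mem_cons, List.not_mem_nil, or_false] at h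
  rcases h with rfl | rfl | rfl
  · exact .inl hs
  · exact (x_notMem_sx hM hac i r hs).elim
  · exact .inr hs

theorem x_mem_first {B : E3SAT n m} {M : Finset (SApp n m × SSch n m)}
    (hst : (ssOf B).Stable M) (hac : (ssOf B).ApplicantComplete M) {i : Fin n} {r : Fin 4}
    {j : Fin m} (hq : (SApp.q j, sx B i r) ∈ M) : (SApp.x i r, SSch.y i (xEnds r).1) ∈ M := by
  refine (x_mem_y hst.1 hac i r).resolve_right fun hz => not_prefersA_sx hst hq hz ?_
  obtain ⟨k, t, h⟩ := exists_sx_eq B i r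
  have hne := xEnds_fst_ne r
  simp [TAPSS.PrefersA, ssOf, ssPrefA_x, h, hne]

theorem ssT_subset_of_mem {B : E3SAT n m} {M : Finset (SApp n m × SSch n m)}
    (hM : (ssOf B).IsMatching M) (hac : (ssOf B).ApplicantComplete M) {i : Fin n}
    (h : (SApp.x i 0, SSch.y i 0) ∈ M ∨ (SApp.x i 1, SSch.y i 1) ∈ M) : ssT i ⊆ M := by
  have key : ∀ {r r' : Fin 4} {y : Fin 4}, (SApp.x i r, SSch.y i y) ∈ M →
      (SApp.x i r', SSch.y i y) ∈ M → r = r' := fun h₁ h₂ => by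
    cases eq_of_mem_of_mem hM h₁ h₂
    rfl
  have h0 : (SApp.x i 0, SSch.y i 0) ∈ M := h.elim id fun h1 =>
    (x_mem_y hM hac i 0).resolve_right fun h0 => absurd (key h0 h1) (by decide)
  have h3 : (SApp.x i 3, SSch.y i 3) ∈ M :=
    (x_mem_y hM hac i 3).resolve_left fun h3 => absurd (key h3 h0) (by decide)
  have h2 : (SApp.x i 2, SSch.y i 2) ∈ M :=
    (x_mem_y hM hac i 2).resolve_left fun h2 => absurd (key h2 h3) (by decide)
  have h1 : (SApp.x i 1, SSch.y i 1) ∈ M :=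
    (x_mem_y hM hac i 1).resolve_right fun h1 => absurd (key h1 h2) (by decide)
  simp [ssT, Finset.insert_subset_iff, h0, h1, h2, h3]

theorem not_ssT_subset_of_mem {B : E3SAT n m} {M : Finset (SApp n m × SSch n m)}
    (hM : (ssOf B).IsMatching M) {i : Fin n}
    (h : (SApp.x i 2, SSch.y i 3) ∈ M ∨ (SApp.x i 3, SSch.y i 0) ∈ M) : ¬ ssT i ⊆ M := by
  intro hT
  rcases h with h | h
  · cases eq_of_mem_of_mem hM h (hT (by simp [ssT]) : (SApp.x i 3, SSch.y i 3) ∈ M)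
  · cases eq_of_mem_of_mem hM h (hT (by simp [ssT]) : (SApp.x i 0, SSch.y i 0) ∈ M)

theorem stmt11 {n m : ℕ} (B : E3SAT n m) (M : Finset (SApp n m × SSch n m))
    (hst : (ssOf B).Stable M) (hac : (ssOf B).ApplicantComplete M) :
    B.Satisfies (fun i => decide (ssT i ⊆ M)) := by
  intro j
  obtain ⟨t, hq⟩ := exists_mem_q hst.1 hac j
  refine ⟨t, ?_⟩
  have hocc := B.occurs_occInv j t
  generalize B.occInv j t = p at hocc
  obtain ⟨v, b, o⟩ := p
  dsimp only at hocc
  have hcl := B.clause_occurs v b o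
  rw [hocc] at hcl
  have first (r : Fin 4) (hr : sx B v r = .s j t) :
      (SApp.x v r, SSch.y v (xEnds r).1) ∈ M :=
    x_mem_first hst hac (hr.symm ▸ hq)
  dsimp only at hcl
  rw [hcl]
  cases b
  · refine decide_eq_false (not_ssT_subset_of_mem hst.1 ?_)
    fin_cases o
    · exact .inl (first 2 (by simp_all [sx]))
    · exact .inr (first 3 (by simp_all [sx]))
  · refine decide_eq_true (ssT_subset_of_mem hst.1 hac ?_)
    fin_cases o
    · exact .inl (first 0 (by simp_all [sx]))
    · exact .inr (first 1 (by simp_all [sx]))
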